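/- arXiv:math/0602366 — 2 statements merged into one kernel-verified Lean document; each statement's English description precedes it below -/
import Mathlib

section
/- Let N = (N_j)_{j≥0} be a strongly regular sequence with growth index γ(N) > 1. Then the logarithmic integral ∫_{-∞}^{+∞} log h_N(|t|)/(1+t²) dt is finite (i.e. greater than -∞; the integrand is nonpositive). -/
noncomputable section

open Filter MeasureTheory
open scoped Topology

def StronglyRegularWith (M : ℕ → ℝ) (A : ℝ) : Prop :=
  (∀ j, 0 < M j) ∧ M 0 = 1 ∧ Monotone M ∧
  (∀ j : ℕ, M (j + 1) * M (j + 1) ≤ M j * M (j + 2)) ∧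
  1 ≤ A ∧
  (∀ j k : ℕ, M (j + k) ≤ A ^ (j + k) * (M j * M k)) ∧
  (∀ ℓ N : ℕ, ∑ j ∈ Finset.range N,
      M (ℓ + j) / (((ℓ + j : ℕ) + 1 : ℝ) * M (ℓ + j + 1)) ≤ A * (M ℓ / M (ℓ + 1)))

def StronglyRegular (M : ℕ → ℝ) : Prop := ∃ A : ℝ, StronglyRegularWith M A

noncomputable def hfn (M : ℕ → ℝ) (t : ℝ) : ℝ :=
  if t = 0 then 0 else ⨅ j : ℕ, t ^ j * M j

def PropertyP (M : ℕ → ℝ) (γ : ℝ) : Prop :=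
  ∃ (m' : ℕ → ℝ) (a : ℝ), 1 ≤ a ∧ (∀ j, 0 < m' j) ∧
    (Monotone fun j : ℕ => ((j : ℝ) + 1) ^ (-γ) * m' j) ∧
    (∀ j : ℕ, a⁻¹ * (M (j + 1) / M j) ≤ m' j ∧ m' j ≤ a * (M (j + 1) / M j))

noncomputable def growthIndex (M : ℕ → ℝ) : ℝ :=
  sSup {γ : ℝ | 0 < γ ∧ PropertyP M γ}

def Sector (γ : ℝ) : Set ℂ :=
  {z : ℂ | z ≠ 0 ∧ |Complex.arg z| < γ * Real.pi / 2}

noncomputable def mixedPartial {n : ℕ} {F : Type*} [NormedAddCommGroup F] [NormedSpace ℝ F]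
    (S : Set (EuclideanSpace ℝ (Fin n))) (f : EuclideanSpace ℝ (Fin n) → F)
    (k : ℕ) (e : Fin k → Fin n) (x : EuclideanSpace ℝ (Fin n)) : F :=
  iteratedFDerivWithin ℝ k f S x fun i => EuclideanSpace.single (e i) 1

lemma PropertyP.exists_pow_mul_factorial_rpow_le {M : ℕ → ℝ} {γ : ℝ} (hpos : ∀ j, 0 < M j)
    (hzero : M 0 = 1) (hP : PropertyP M γ) :
    ∃ c : ℝ, 0 < c ∧ ∀ j : ℕ, c ^ j * (j.factorial : ℝ) ^ γ ≤ M j := by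
  obtain ⟨m', a, ha, hm', hmono, hcomp⟩ := hP
  have ha0 : 0 < a := by linarith
  refine ⟨a⁻¹ * m' 0, mul_pos (inv_pos.2 ha0) (hm' 0), fun j => ?_⟩
  induction j with
  | zero => simp [hzero]
  | succ j ih =>
    have hj : (0 : ℝ) < (j : ℝ) + 1 := by positivity
    have h1 : m' 0 ≤ ((j : ℝ) + 1) ^ (-γ) * m' j := by
      simpa using hmono (Nat.zero_le j)
    have h2 : m' 0 * ((j : ℝ) + 1) ^ γ ≤ m' j := by
      rw [Real.rpow_neg hj.le] at h1
      have hp := Real.rpow_pos_of_pos hj γ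
      calc m' 0 * ((j : ℝ) + 1) ^ γ
          ≤ ((((j : ℝ) + 1) ^ γ)⁻¹ * m' j) * ((j : ℝ) + 1) ^ γ := by gcongr
        _ = m' j := by field_simp
    have h3 : a⁻¹ * m' 0 * ((j : ℝ) + 1) ^ γ ≤ M (j + 1) / M j := by
      have h4 : a⁻¹ * (m' 0 * ((j : ℝ) + 1) ^ γ) ≤ a⁻¹ * (a * (M (j + 1) / M j)) :=
        mul_le_mul_of_nonneg_left (h2.trans (hcomp j).2) (inv_pos.2 ha0).le
      rwa [inv_mul_cancel_left₀ ha0.ne', ← mul_assoc] at h4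
    have hm0 := hm' 0
    have hf : (((j + 1).factorial : ℕ) : ℝ) ^ γ =
        ((j : ℝ) + 1) ^ γ * (j.factorial : ℝ) ^ γ := by
      rw [Nat.factorial_succ]
      push_cast
      exact Real.mul_rpow hj.le (by positivity)
    calc (a⁻¹ * m' 0) ^ (j + 1) * (((j + 1).factorial : ℕ) : ℝ) ^ γ
        = (a⁻¹ * m' 0 * ((j : ℝ) + 1) ^ γ) *
            ((a⁻¹ * m' 0) ^ j * (j.factorial : ℝ) ^ γ) := by rw [hf]; ring
      _ ≤ (M (j + 1) / M j) * M j :=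
          mul_le_mul h3 ih (by positivity) (div_pos (hpos _) (hpos _)).le
      _ = M (j + 1) := div_mul_cancel₀ _ (hpos j).ne'

lemma exp_neg_inv_le_pow_mul_factorial {s : ℝ} (hs : 0 < s) (j : ℕ) :
    Real.exp (-s⁻¹) ≤ s ^ j * (j.factorial : ℝ) := by
  have h := Real.pow_div_factorial_le_exp s⁻¹ (inv_pos.2 hs).le j
  rw [Real.exp_neg, inv_le_comm₀ (Real.exp_pos _) (by positivity)]
  rwa [mul_inv, ← inv_pow, ← div_eq_mul_inv]

lemma exp_le_hfn {M : ℕ → ℝ} {γ c t : ℝ} (hγ : 0 < γ) (hc : 0 < c) (ht : 0 < t)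
    (hM : ∀ j : ℕ, c ^ j * (j.factorial : ℝ) ^ γ ≤ M j) :
    Real.exp (-(γ * c ^ (-γ⁻¹) * t ^ (-γ⁻¹))) ≤ hfn M t := by
  rw [hfn, if_neg ht.ne']
  refine le_ciInf fun j => ?_
  have hct : 0 < c * t := mul_pos hc ht
  have hs : 0 < (c * t) ^ γ⁻¹ := Real.rpow_pos_of_pos hct _
  have h1 := Real.rpow_le_rpow (Real.exp_pos _).le (exp_neg_inv_le_pow_mul_factorial hs j) hγ.le
  have h2 : Real.exp (-((c * t) ^ γ⁻¹)⁻¹) ^ γ =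
      Real.exp (-(γ * c ^ (-γ⁻¹) * t ^ (-γ⁻¹))) := by
    rw [← Real.exp_mul, ← Real.rpow_neg hct.le, Real.mul_rpow hc.le ht.le]
    ring_nf
  have h3 : (((c * t) ^ γ⁻¹) ^ j * (j.factorial : ℝ)) ^ γ =
      t ^ j * (c ^ j * (j.factorial : ℝ) ^ γ) := by
    rw [Real.mul_rpow (by positivity) (by positivity), ← Real.rpow_pow_comm hs.le,
      Real.rpow_inv_rpow hct.le hγ.ne', mul_pow]
    ring
  rw [h2, h3] at h1
  exact h1.trans (by gcongr; exact hM j)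

lemma hfn_le_one {M : ℕ → ℝ} {t : ℝ} (hpos : ∀ j, 0 < M j) (hzero : M 0 = 1) (ht : 0 ≤ t) :
    hfn M t ≤ 1 := by
  rw [hfn]
  split_ifs
  · exact zero_le_one
  · have hb : BddBelow (Set.range fun j : ℕ => t ^ j * M j) :=
      ⟨0, by rintro _ ⟨j, rfl⟩; exact mul_nonneg (pow_nonneg ht j) (hpos j).le⟩
    simpa [hzero] using ciInf_le hb 0

lemma abs_log_hfn_le {M : ℕ → ℝ} {γ c t : ℝ} (hγ : 0 < γ) (hc : 0 < c) (ht : 0 < t)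
    (hpos : ∀ j, 0 < M j) (hzero : M 0 = 1)
    (hM : ∀ j : ℕ, c ^ j * (j.factorial : ℝ) ^ γ ≤ M j) :
    |Real.log (hfn M t)| ≤ γ * c ^ (-γ⁻¹) * t ^ (-γ⁻¹) := by
  have h := exp_le_hfn hγ hc ht hM
  have hh : 0 < hfn M t := (Real.exp_pos _).trans_le h
  rw [abs_of_nonpos (Real.log_nonpos hh.le (hfn_le_one hpos hzero ht.le))]
  linarith [(Real.le_log_iff_exp_le hh).2 h]

lemma measurable_hfn (M : ℕ → ℝ) : Measurable (hfn M) := by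
  unfold hfn
  exact Measurable.ite (measurableSet_singleton 0) measurable_const
    (Measurable.iInf fun j => (measurable_id.pow_const j).mul_const (M j))

lemma integrable_abs_rpow_neg_div_one_add_sq {r : ℝ} (hr₀ : 0 ≤ r) (hr : r < 1) :
    Integrable fun t : ℝ => |t| ^ (-r) / (1 + t ^ 2) := by
  set g : ℝ → ℝ := (Set.Ioo 0 1).indicator fun t => t ^ (-r)
  have hg : Integrable g := by
    rw [integrable_indicator_iff measurableSet_Ioo,
      intervalIntegral.integrableOn_Ioo_rpow_iff one_pos]
    linarith
  have hg₀ : ∀ t, 0 ≤ g t := fun t =>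
    Set.indicator_nonneg (fun x hx => Real.rpow_nonneg hx.1.le _) t
  have hmeas : Measurable fun t : ℝ => |t| ^ (-r) / (1 + t ^ 2) := by fun_prop
  refine ((hg.add hg.comp_neg).add integrable_inv_one_add_sq).mono' hmeas.aestronglyMeasurable ?_
  filter_upwards [compl_mem_ae_iff.2 (measure_singleton (0 : ℝ))] with t ht
  have ht : t ≠ 0 := ht
  have hpow : 0 ≤ |t| ^ (-r) := Real.rpow_nonneg (abs_nonneg t) _
  have hinv : 0 ≤ (1 + t ^ 2)⁻¹ := by positivity
  rw [Real.norm_of_nonneg (by positivity)]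
  change _ ≤ g t + g (-t) + (1 + t ^ 2)⁻¹
  rcases le_or_gt 1 |t| with h | h
  · have h1 : |t| ^ (-r) ≤ 1 := Real.rpow_le_one_of_one_le_of_nonpos h (by linarith)
    have h2 : |t| ^ (-r) / (1 + t ^ 2) ≤ (1 + t ^ 2)⁻¹ := by
      rw [div_eq_mul_inv]
      exact mul_le_of_le_one_left hinv h1
    linarith [hg₀ t, hg₀ (-t)]
  · have h1 : |t| ^ (-r) / (1 + t ^ 2) ≤ |t| ^ (-r) :=
      div_le_self hpow (by nlinarith [sq_nonneg t])
    have h2 : |t| ^ (-r) ≤ g t + g (-t) := by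
      rcases ht.lt_or_gt with h0 | h0
      · rw [abs_of_neg h0] at h ⊢
        have h3 : g (-t) = (-t) ^ (-r) := Set.indicator_of_mem (Set.mem_Ioo.2 ⟨by linarith, h⟩) _
        linarith [hg₀ t]
      · rw [abs_of_pos h0] at h ⊢
        have h3 : g t = t ^ (-r) := Set.indicator_of_mem (Set.mem_Ioo.2 ⟨h0, h⟩) _
        linarith [hg₀ (-t)]
    linarith

lemma exists_propertyP_of_lt_growthIndex {M : ℕ → ℝ} {a : ℝ} (ha : 0 ≤ a)
    (h : a < growthIndex M) : ∃ γ, a < γ ∧ PropertyP M γ := by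
  have hne : {γ : ℝ | 0 < γ ∧ PropertyP M γ}.Nonempty := by
    by_contra hne
    rw [Set.not_nonempty_iff_eq_empty] at hne
    rw [growthIndex, hne, Real.sSup_empty] at h
    linarith
  obtain ⟨γ, hγ, hlt⟩ := exists_lt_of_lt_csSup hne h
  exact ⟨γ, hlt, hγ.2⟩

/-- for strongly regular `N` with `γ(N) > 1`, the logarithmic integral
`∫_{-∞}^{∞} log h_N(|t|)/(1+t²) dt` is finite, i.e. the (nonpositive) integrand is
Lebesgue integrable on `ℝ`. -/
theorem stmt10 (N : ℕ → ℝ) (hN : StronglyRegular N) (hγ : 1 < growthIndex N) :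
    MeasureTheory.Integrable (fun t : ℝ => Real.log (hfn N |t|) / (1 + t ^ 2)) := by
  obtain ⟨A, hpos, hzero, -⟩ := hN
  obtain ⟨γ, hγ1, hP⟩ := exists_propertyP_of_lt_growthIndex zero_le_one hγ
  obtain ⟨c, hc, hM⟩ := hP.exists_pow_mul_factorial_rpow_le hpos hzero
  have hγ0 : 0 < γ := one_pos.trans hγ1
  have hmeas : Measurable fun t : ℝ => Real.log (hfn N |t|) / (1 + t ^ 2) :=
    (Real.measurable_log.comp ((measurable_hfn N).comp measurable_abs)).div (by fun_prop)
  refine ((integrable_abs_rpow_neg_div_one_add_sq (inv_nonneg.2 hγ0.le)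
    (inv_lt_one_of_one_lt₀ hγ1)).const_mul (γ * c ^ (-γ⁻¹))).mono'
      hmeas.aestronglyMeasurable ?_
  filter_upwards [compl_mem_ae_iff.2 (measure_singleton (0 : ℝ))] with t ht
  have hden : 0 < 1 + t ^ 2 := by positivity
  rw [Real.norm_eq_abs, abs_div, abs_of_pos hden, ← mul_div_assoc]
  gcongr
  exact abs_log_hfn_le hγ0 hc (abs_pos.2 ht) hpos hzero hM
end
end

section
/- Let M = (M_j)_{j≥0} be a strongly regular sequence and let γ be a real number with 0 < γ < γ(M) and γ < 2 (the restriction γ < 2 ensures that the sector S_γ is a subset of ℂ). Then there exist a holomorphic function G on the sector S_γ = {z ∈ ℂ \ {0} : |Arg z| < γπ/2} and constants σ > 0, C > 0, κ₁ > 0, κ₂ > 0, κ₃ > 0, depending only on M and γ, such that |G^{(j)}(z)| ≤ C σ^j j! M_j for all j ∈ ℕ and z ∈ S_γ, and κ₁ · h_M(κ₂|z|) ≤ |G(z)| ≤ h_M(κ₃|z|) for every z ∈ S_γ. -/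
noncomputable section

open Filter MeasureTheory
open scoped Topology

theorem exists_lt_propertyP {M : ℕ → ℝ} {γ : ℝ} (hγ0 : 0 < γ) (h : γ < growthIndex M) :
    ∃ γ', γ < γ' ∧ PropertyP M γ' := by
  unfold growthIndex at h
  have hne : {γ : ℝ | 0 < γ ∧ PropertyP M γ}.Nonempty := by
    by_contra hne
    rw [Set.not_nonempty_iff_eq_empty] at hne
    rw [hne, Real.sSup_empty] at h
    linarith
  obtain ⟨γ', ⟨-, hP⟩, hlt⟩ := exists_lt_of_lt_csSup hne h
  exact ⟨γ', hlt, hP⟩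

/-- Comparison of a dilated `p`-series with the `p`-series, block by block. -/
theorem sum_range_div_rpow_le {p : ℝ} (hp : 1 < p) (n : ℕ) (hn : 0 < n) (k : ℕ) :
    ∑ i ∈ Finset.range k, (((n + i : ℕ) : ℝ) / n) ^ (-p) ≤
      n * ∑' i : ℕ, ((i : ℝ) + 1) ^ (-p) := by
  have hs : Summable fun i : ℕ => ((i : ℝ) + 1) ^ (-p) := by
    have := (summable_nat_add_iff 1).2 (Real.summable_nat_rpow.2 (neg_lt_neg hp))
    simpa using this
  have hn' : (0 : ℝ) < n := by exact_mod_cast hn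
  have hblock : ∀ Q : ℕ, ∑ i ∈ Finset.range (n * Q), (((n + i : ℕ) : ℝ) / n) ^ (-p) ≤
      n * ∑ q ∈ Finset.range Q, ((q : ℝ) + 1) ^ (-p) := by
    intro Q
    induction Q with
    | zero => simp
    | succ Q ih =>
      rw [Nat.mul_succ, Finset.sum_range_add, Finset.sum_range_succ _ Q, mul_add]
      refine add_le_add ih ?_
      calc ∑ x ∈ Finset.range n, (((n + (n * Q + x) : ℕ) : ℝ) / n) ^ (-p)
          ≤ ∑ x ∈ Finset.range n, ((Q : ℝ) + 1) ^ (-p) := by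
            refine Finset.sum_le_sum fun x _ => ?_
            refine Real.rpow_le_rpow_of_nonpos (by positivity) ?_ (by linarith)
            rw [le_div_iff₀ hn']
            push_cast
            have : (0 : ℝ) ≤ x := Nat.cast_nonneg x
            nlinarith
        _ = n * ((Q : ℝ) + 1) ^ (-p) := by simp
  calc ∑ i ∈ Finset.range k, (((n + i : ℕ) : ℝ) / n) ^ (-p)
      ≤ ∑ i ∈ Finset.range (n * k), (((n + i : ℕ) : ℝ) / n) ^ (-p) := by
        refine Finset.sum_le_sum_of_subset_of_nonneg ?_ fun _ _ _ => by positivity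
        exact Finset.range_mono (Nat.le_mul_of_pos_left k hn)
    _ ≤ n * ∑ q ∈ Finset.range k, ((q : ℝ) + 1) ^ (-p) := hblock k
    _ ≤ n * ∑' i : ℕ, ((i : ℝ) + 1) ^ (-p) := by
        gcongr
        exact hs.sum_le_tsum _ fun _ _ => by positivity

theorem PropertyP.quotient_le {M : ℕ → ℝ} {γ : ℝ} (h : PropertyP M γ) :
    ∃ B : ℝ, 0 < B ∧ ∀ N i : ℕ, (((N + 1 + i : ℕ) : ℝ) / (N + 1 : ℕ)) ^ γ *
      (M (N + 1) / M N) ≤ B * (M (N + i + 1) / M (N + i)) := by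
  obtain ⟨m', a, ha, hpos, hmono, hb⟩ := h
  have ha0 : 0 < a := by linarith
  refine ⟨a * a, by positivity, fun N i => ?_⟩
  have h1 := hmono (Nat.le_add_right N i)
  have h2 := (hb N).1
  have h3 := (hb (N + i)).2
  simp only at h1
  have hx : (0 : ℝ) < (N : ℝ) + 1 := by positivity
  have hy : (0 : ℝ) < ((N + i : ℕ) : ℝ) + 1 := by positivity
  have hyy : ((N + 1 + i : ℕ) : ℝ) = ((N + i : ℕ) : ℝ) + 1 := by push_cast; ring
  have hxx : ((N + 1 : ℕ) : ℝ) = (N : ℝ) + 1 := by push_cast; ring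
  rw [hyy, hxx, Real.div_rpow hy.le hx.le]
  rw [Real.rpow_neg hx.le, Real.rpow_neg hy.le] at h1
  set X := ((N : ℝ) + 1) ^ γ
  set Y := (((N + i : ℕ) : ℝ) + 1) ^ γ
  have hX : 0 < X := Real.rpow_pos_of_pos hx _
  have hY : 0 < Y := Real.rpow_pos_of_pos hy _
  have h4 : M (N + 1) / M N ≤ a * m' N := by
    rwa [inv_mul_le_iff₀ ha0] at h2
  have h5 : Y / X * m' N ≤ m' (N + i) := by
    have := mul_le_mul_of_nonneg_left h1 hY.le
    rw [mul_inv_cancel_left₀ hY.ne'] at this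
    rwa [div_eq_mul_inv, mul_assoc]
  calc Y / X * (M (N + 1) / M N) ≤ Y / X * (a * m' N) := by gcongr
    _ = a * (Y / X * m' N) := by ring
    _ ≤ a * (a * (M (N + i + 1) / M (N + i))) := mul_le_mul_of_nonneg_left (h5.trans h3) ha0.le
    _ = a * a * (M (N + i + 1) / M (N + i)) := by ring

theorem one_le_norm_one_add {x : ℂ} (hx : 0 ≤ x.re) : 1 ≤ ‖1 + x‖ := by
  have := Complex.re_le_norm (1 + x)
  simp at this
  linarith

theorem norm_le_norm_one_add {x : ℂ} (hx : 0 ≤ x.re) : ‖x‖ ≤ ‖1 + x‖ := by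
  rw [← sq_le_sq₀ (norm_nonneg _) (norm_nonneg _), ← Complex.normSq_eq_norm_sq,
    ← Complex.normSq_eq_norm_sq, Complex.normSq_apply, Complex.normSq_apply]
  simp
  nlinarith

theorem one_add_mem_slitPlane {x : ℂ} (hx : 0 ≤ x.re) : 1 + x ∈ Complex.slitPlane := by
  left
  simp
  linarith

theorem norm_log_one_add_le_of_re_nonneg {x : ℂ} (hx : 0 ≤ x.re) :
    ‖Complex.log (1 + x)‖ ≤ ‖x‖ := by
  have hconv : Convex ℝ {w : ℂ | 0 ≤ w.re} := convex_halfSpace_re_ge 0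
  have := hconv.norm_image_sub_le_of_norm_hasDerivWithin_le (𝕜 := ℂ)
    (f := fun w => Complex.log (1 + w)) (f' := fun w => 1 / (1 + w)) (C := 1) (x := 0) (y := x)
    (fun w hw => (((hasDerivAt_id w).const_add 1).clog
      (one_add_mem_slitPlane hw)).hasDerivWithinAt)
    (fun w hw => by
      rw [norm_div, norm_one]
      exact div_le_one_of_le₀ (one_le_norm_one_add hw) (norm_nonneg _)) (le_refl (0 : ℝ)) hx
  simpa using this

/-- The logarithm of the product `∏ (1 + b j * w)`. -/
def logProd (b : ℕ → ℝ) (w : ℂ) : ℂ := ∑' j, Complex.log (1 + b j * w)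

theorem re_ofReal_mul_nonneg {b : ℝ} (hb : 0 < b) {w : ℂ} (hw : 0 < w.re) :
    0 ≤ ((b : ℂ) * w).re := by
  rw [Complex.re_ofReal_mul]
  positivity

theorem norm_log_one_add_ofReal_mul_le {b : ℝ} (hb : 0 < b) {w : ℂ} (hw : 0 < w.re) :
    ‖Complex.log (1 + b * w)‖ ≤ b * ‖w‖ := by
  refine (norm_log_one_add_le_of_re_nonneg (re_ofReal_mul_nonneg hb hw)).trans_eq ?_
  rw [norm_mul, Complex.norm_real, Real.norm_of_nonneg hb.le]

theorem summable_log_one_add_mul {b : ℕ → ℝ} (hb : ∀ j, 0 < b j) (hs : Summable b) {w : ℂ}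
    (hw : 0 < w.re) : Summable fun j => Complex.log (1 + b j * w) :=
  Summable.of_norm_bounded (hs.mul_right ‖w‖) fun j => norm_log_one_add_ofReal_mul_le (hb j) hw

theorem differentiableOn_logProd {b : ℕ → ℝ} (hb : ∀ j, 0 < b j) (hs : Summable b) :
    DifferentiableOn ℂ (logProd b) {w | 0 < w.re} := by
  intro w hw
  have hopen : IsOpen ({w : ℂ | 0 < w.re} ∩ Metric.ball 0 (‖w‖ + 1)) :=
    (isOpen_lt continuous_const Complex.continuous_re).inter Metric.isOpen_ball
  have hd : DifferentiableOn ℂ (logProd b) ({w : ℂ | 0 < w.re} ∩ Metric.ball 0 (‖w‖ + 1)) := by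
    refine Complex.differentiableOn_tsum_of_summable_norm (hs.mul_right (‖w‖ + 1)) ?_ hopen ?_
    · intro j v hv
      refine DifferentiableAt.differentiableWithinAt ?_
      exact DifferentiableAt.clog (by fun_prop)
        (one_add_mem_slitPlane (re_ofReal_mul_nonneg (hb j) hv.1))
    · intro j v hv
      refine (norm_log_one_add_ofReal_mul_le (hb j) hv.1).trans ?_
      have := hv.2
      rw [mem_ball_zero_iff] at this
      exact mul_le_mul_of_nonneg_left this.le (hb j).le
  exact (hd.differentiableAt (hopen.mem_nhds ⟨hw, by simp⟩)).differentiableWithinAt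

theorem hasSum_re_logProd {b : ℕ → ℝ} (hb : ∀ j, 0 < b j) (hs : Summable b) {w : ℂ}
    (hw : 0 < w.re) : HasSum (fun j => Real.log ‖1 + b j * w‖) (logProd b w).re := by
  have := Complex.hasSum_re (summable_log_one_add_mul hb hs hw).hasSum
  simpa only [Complex.log_re, logProd] using this

/-- A flat function modelled on the sequence `b`; it is the product of the factors
`(1 + b j * z ^ (-s)) ^ (-1 / s)`. -/
def flatFun (b : ℕ → ℝ) (s : ℝ) (z : ℂ) : ℂ :=
  Complex.exp (-((s⁻¹ : ℝ) : ℂ) * logProd b (Complex.exp (-(s : ℂ) * Complex.log z)))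

theorem norm_exp_neg_mul_log (s : ℝ) {z : ℂ} (hz : z ≠ 0) :
    ‖Complex.exp (-(s : ℂ) * Complex.log z)‖ = ‖z‖ ^ (-s) := by
  rw [Complex.norm_exp, Real.rpow_def_of_pos (norm_pos_iff.2 hz)]
  simp [Complex.log_re, mul_comm]

theorem re_exp_neg_mul_log_pos {s : ℝ} (hs : 0 < s) {z : ℂ}
    (h : s * |z.arg| < Real.pi / 2) : 0 < (Complex.exp (-(s : ℂ) * Complex.log z)).re := by
  rw [Complex.exp_re]
  refine mul_pos (Real.exp_pos _) ?_
  have him : (-(s : ℂ) * Complex.log z).im = -(s * z.arg) := by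
    simp [Complex.log_im]
  rw [him, Real.cos_neg, ← Real.cos_abs, abs_mul, abs_of_pos hs]
  exact Real.cos_pos_of_mem_Ioo ⟨by linarith [Real.pi_pos, mul_nonneg hs.le (abs_nonneg z.arg)], h⟩

theorem norm_flatFun (b : ℕ → ℝ) (s : ℝ) (z : ℂ) :
    ‖flatFun b s z‖ =
      Real.exp (-s⁻¹ * (logProd b (Complex.exp (-(s : ℂ) * Complex.log z))).re) := by
  rw [flatFun, Complex.norm_exp, ← Complex.ofReal_neg, Complex.re_ofReal_mul]

theorem differentiableOn_flatFun {b : ℕ → ℝ} (hb : ∀ j, 0 < b j) (hsum : Summable b) {s : ℝ}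
    (hs : 0 < s) :
    DifferentiableOn ℂ (flatFun b s)
      (Complex.slitPlane ∩ {z | s * |z.arg| < Real.pi / 2}) := by
  refine DifferentiableOn.cexp (DifferentiableOn.const_mul ?_ _)
  refine (differentiableOn_logProd hb hsum).comp
    (g := logProd b) (f := fun z => Complex.exp (-(s : ℂ) * Complex.log z)) ?_ fun z hz =>
      re_exp_neg_mul_log_pos hs hz.2
  intro z hz
  exact (((Complex.differentiableAt_log hz.1).const_mul _).cexp).differentiableWithinAt

theorem prod_quotient {M : ℕ → ℝ} (hpos : ∀ j, 0 < M j) (h0 : M 0 = 1) (t : ℝ) (k : ℕ) :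
    ∏ j ∈ Finset.range k, (M (j + 1) / M j * t) = t ^ k * M k := by
  induction k with
  | zero => simp [h0]
  | succ k ih =>
    rw [Finset.prod_range_succ, ih, pow_succ]
    field_simp [(hpos k).ne']

theorem hfn_le {M : ℕ → ℝ} (hpos : ∀ j, 0 < M j) {t : ℝ} (ht : 0 < t) (k : ℕ) :
    hfn M t ≤ t ^ k * M k := by
  rw [hfn, if_neg ht.ne']
  refine ciInf_le ⟨0, ?_⟩ k
  rintro _ ⟨j, rfl⟩
  have := hpos j
  positivity

theorem sum_log_quotient_rpow {M : ℕ → ℝ} (hpos : ∀ j, 0 < M j) (h0 : M 0 = 1) {s t : ℝ}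
    (ht : 0 < t) (k : ℕ) :
    ∑ j ∈ Finset.range k, Real.log ((M (j + 1) / M j) ^ (-s) * t ^ (-s)) =
      -s * Real.log (t ^ k * M k) := by
  have hq : ∀ j, 0 < M (j + 1) / M j := fun j => div_pos (hpos _) (hpos _)
  rw [← prod_quotient hpos h0, Real.log_prod (fun j _ => (mul_pos (hq j) ht).ne'), Finset.mul_sum]
  refine Finset.sum_congr rfl fun j _ => ?_
  rw [← Real.mul_rpow (hq j).le ht.le, Real.log_rpow (mul_pos (hq j) ht)]

theorem norm_flatFun_le {M : ℕ → ℝ} (hpos : ∀ j, 0 < M j) (h0 : M 0 = 1) {s : ℝ} (hs : 0 < s)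
    (hsum : Summable fun j => (M (j + 1) / M j) ^ (-s)) {z : ℂ} (hz : z ≠ 0)
    (harg : s * |z.arg| < Real.pi / 2) (k : ℕ) :
    ‖flatFun (fun j => (M (j + 1) / M j) ^ (-s)) s z‖ ≤ ‖z‖ ^ k * M k := by
  have ht : 0 < ‖z‖ := norm_pos_iff.2 hz
  have hb : ∀ j, 0 < (M (j + 1) / M j) ^ (-s) := fun j =>
    Real.rpow_pos_of_pos (div_pos (hpos _) (hpos _)) _
  have hw := re_exp_neg_mul_log_pos hs harg
  have hsm := hasSum_re_logProd hb hsum hw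
  have hn := norm_exp_neg_mul_log s hz
  rw [norm_flatFun]
  set w := Complex.exp (-(s : ℂ) * Complex.log z)
  have hP : 0 < ‖z‖ ^ k * M k := mul_pos (pow_pos ht k) (hpos k)
  rw [← Real.le_log_iff_exp_le hP, neg_mul, neg_le, le_inv_mul_iff₀ hs]
  have h1 := sum_log_quotient_rpow hpos h0 (s := s) ht k
  have h2 : ∑ j ∈ Finset.range k, Real.log ((M (j + 1) / M j) ^ (-s) * ‖z‖ ^ (-s)) ≤
      ∑ j ∈ Finset.range k, Real.log ‖1 + ((M (j + 1) / M j) ^ (-s) : ℝ) * w‖ := by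
    refine Finset.sum_le_sum fun j _ => Real.log_le_log
      (mul_pos (hb j) (Real.rpow_pos_of_pos ht _)) ?_
    refine le_trans (le_of_eq ?_) (norm_le_norm_one_add (re_ofReal_mul_nonneg (hb j) hw))
    rw [norm_mul, hn, Complex.norm_real, Real.norm_of_nonneg (hb j).le]
  have h3 := sum_le_hasSum (Finset.range k) (fun j _ => Real.log_nonneg
    (one_le_norm_one_add (re_ofReal_mul_nonneg (hb j) hw))) hsm
  linarith

theorem le_norm_flatFun {M : ℕ → ℝ} (hpos : ∀ j, 0 < M j) (h0 : M 0 = 1) {s K : ℝ} (hs : 0 < s)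
    (hsum : Summable fun j => (M (j + 1) / M j) ^ (-s))
    (hex : ∀ t : ℝ, 0 < t → ∃ N, 1 ≤ M (N + 1) / M N * t)
    (htail : ∀ N k : ℕ, ∑ i ∈ Finset.range k, (M (N + i + 1) / M (N + i)) ^ (-s) ≤
      K * (N + 1) * (M (N + 1) / M N) ^ (-s)) {z : ℂ} (hz : z ≠ 0)
    (harg : s * |z.arg| < Real.pi / 2) :
    Real.exp (-s⁻¹ * K) * hfn M (Real.exp (-s⁻¹ * (Real.log 2 + K)) * ‖z‖) ≤
      ‖flatFun (fun j => (M (j + 1) / M j) ^ (-s)) s z‖ := by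
  classical
  have ht : 0 < ‖z‖ := norm_pos_iff.2 hz
  have hq : ∀ j, 0 < M (j + 1) / M j := fun j => div_pos (hpos _) (hpos _)
  have hb : ∀ j, 0 < (M (j + 1) / M j) ^ (-s) := fun j => Real.rpow_pos_of_pos (hq j) _
  have hw := re_exp_neg_mul_log_pos hs harg
  have hsm := hasSum_re_logProd hb hsum hw
  have hn := norm_exp_neg_mul_log s hz
  have hK : 0 ≤ K := by
    have := htail 0 0
    simp only [Finset.range_zero, Finset.sum_empty] at this
    have h2 := hb 0
    push_cast at this
    by_contra hneg
    have : K * (0 + 1) * (M (0 + 1) / M 0) ^ (-s) < 0 :=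
      mul_neg_of_neg_of_pos (by linarith) h2
    linarith
  set N := Nat.find (hex ‖z‖ ht)
  have hN1 : 1 ≤ M (N + 1) / M N * ‖z‖ := Nat.find_spec (hex ‖z‖ ht)
  have hN2 : ∀ j < N, M (j + 1) / M j * ‖z‖ < 1 := fun j hj =>
    not_le.1 (Nat.find_min (hex ‖z‖ ht) hj)
  refine (mul_le_mul_of_nonneg_left (hfn_le hpos (mul_pos (Real.exp_pos _) ht) N)
    (Real.exp_pos _).le).trans ?_
  rw [norm_flatFun]
  set w := Complex.exp (-(s : ℂ) * Complex.log z)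
  have hnorm : ∀ j, ‖(((M (j + 1) / M j) ^ (-s) : ℝ) : ℂ) * w‖ =
      (M (j + 1) / M j) ^ (-s) * ‖z‖ ^ (-s) := fun j => by
    rw [norm_mul, hn, Complex.norm_real, Real.norm_of_nonneg (hb j).le]
  have hle : ∀ j, ‖1 + (((M (j + 1) / M j) ^ (-s) : ℝ) : ℂ) * w‖ ≤
      1 + (M (j + 1) / M j) ^ (-s) * ‖z‖ ^ (-s) := fun j => by
    refine (norm_add_le _ _).trans_eq ?_
    rw [hnorm, norm_one]
  have hge : ∀ j, 1 ≤ ‖1 + (((M (j + 1) / M j) ^ (-s) : ℝ) : ℂ) * w‖ := fun j =>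
    one_le_norm_one_add (re_ofReal_mul_nonneg (hb j) hw)
  have hhead : ∑ j ∈ Finset.range N, Real.log ‖1 + (((M (j + 1) / M j) ^ (-s) : ℝ) : ℂ) * w‖ ≤
      N * Real.log 2 - s * Real.log (‖z‖ ^ N * M N) := by
    have h1 := sum_log_quotient_rpow hpos h0 (s := s) ht N
    calc _ ≤ ∑ j ∈ Finset.range N, (Real.log 2 +
          Real.log ((M (j + 1) / M j) ^ (-s) * ‖z‖ ^ (-s))) := by
          refine Finset.sum_le_sum fun j hj => ?_
          have hj' := hN2 j (Finset.mem_range.1 hj)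
          have hone : 1 ≤ (M (j + 1) / M j) ^ (-s) * ‖z‖ ^ (-s) := by
            rw [← Real.mul_rpow (hq j).le ht.le]
            exact Real.one_le_rpow_of_pos_of_le_one_of_nonpos (mul_pos (hq j) ht) hj'.le
              (by linarith)
          rw [← Real.log_mul (by norm_num) (by linarith)]
          refine Real.log_le_log (by linarith [hge j]) ?_
          linarith [hle j]
      _ = _ := by
          rw [Finset.sum_add_distrib, h1]
          simp
          ring
  have hsumm := hsm.summable
  have hrest : ∑' i, Real.log ‖1 + (((M (i + N + 1) / M (i + N)) ^ (-s) : ℝ) : ℂ) * w‖ ≤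
      K * (N + 1) := by
    refine Real.tsum_le_of_sum_range_le (fun i => Real.log_nonneg (hge (i + N))) fun k => ?_
    calc _ ≤ ∑ i ∈ Finset.range k, (M (N + i + 1) / M (N + i)) ^ (-s) * ‖z‖ ^ (-s) := by
          refine Finset.sum_le_sum fun i _ => ?_
          rw [add_comm i N]
          have := Real.log_le_sub_one_of_pos (by linarith [hge (N + i)] :
            0 < ‖1 + (((M (N + i + 1) / M (N + i)) ^ (-s) : ℝ) : ℂ) * w‖)
          linarith [hle (N + i)]
      _ = (∑ i ∈ Finset.range k, (M (N + i + 1) / M (N + i)) ^ (-s)) * ‖z‖ ^ (-s) := by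
          rw [Finset.sum_mul]
      _ ≤ (K * (N + 1) * (M (N + 1) / M N) ^ (-s)) * ‖z‖ ^ (-s) := by
          gcongr
          exact htail N k
      _ = K * (N + 1) * (M (N + 1) / M N * ‖z‖) ^ (-s) := by
          rw [Real.mul_rpow (hq N).le ht.le, mul_assoc]
      _ ≤ K * (N + 1) * 1 := by
          gcongr
          exact Real.rpow_le_one_of_one_le_of_nonpos hN1 (by linarith)
      _ = K * (N + 1) := mul_one _
  have htot : (logProd (fun j => (M (j + 1) / M j) ^ (-s)) w).re ≤
      N * Real.log 2 - s * Real.log (‖z‖ ^ N * M N) + K * (N + 1) := by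
    rw [← hsm.tsum_eq, ← hsumm.sum_add_tsum_nat_add N]
    exact add_le_add hhead hrest
  have hP : 0 < ‖z‖ ^ N * M N := mul_pos (pow_pos ht N) (hpos N)
  rw [mul_pow, mul_assoc, ← Real.exp_nat_mul, ← Real.exp_log hP, ← Real.exp_add, ← Real.exp_add,
    Real.exp_le_exp]
  have := mul_le_mul_of_nonneg_left htot (inv_pos.2 hs).le
  have hcancel : s⁻¹ * (s * Real.log (‖z‖ ^ N * M N)) = Real.log (‖z‖ ^ N * M N) :=
    inv_mul_cancel_left₀ hs.ne' _
  nlinarith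

theorem isOpen_sector {γ : ℝ} (hγ : γ < 2) : IsOpen (Sector γ) := by
  have h : Sector γ = Complex.slitPlane ∩ {z | |z.arg| < γ * Real.pi / 2} := by
    ext z
    simp only [Sector, Set.mem_ofPred_eq, Set.mem_inter_iff, Complex.mem_slitPlane_iff_arg]
    refine ⟨fun hz => ⟨⟨fun harg => ?_, hz.1⟩, hz.2⟩, fun hz => ⟨hz.1.2, hz.2⟩⟩
    have := hz.2
    rw [harg, abs_of_pos Real.pi_pos] at this
    nlinarith [Real.pi_pos]
  rw [h]
  have hc : ContinuousOn (fun z : ℂ => |z.arg|) Complex.slitPlane := fun z hz =>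
    (Complex.continuousAt_arg hz).abs.continuousWithinAt
  exact hc.isOpen_inter_preimage Complex.isOpen_slitPlane isOpen_Iio

/-- Discs of radius proportional to the distance to the origin, centred in a sector, lie in a
slightly wider sector. -/
theorem exists_closedBall_subset_sector {γ δ : ℝ} (hγδ : γ < δ) (hδ : δ < 2) :
    ∃ c : ℝ, 0 < c ∧ ∀ z ∈ Sector γ, Metric.closedBall z (c * ‖z‖) ⊆ Sector δ := by
  have hη : 0 < (δ - γ) * Real.pi / 2 := by
    have := Real.pi_pos
    have : 0 < δ - γ := sub_pos.2 hγδ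
    positivity
  have hcont : ContinuousAt Complex.arg 1 := Complex.continuousAt_arg (by simp)
  obtain ⟨ε, hε, hball⟩ := Metric.continuousAt_iff.1 hcont _ hη
  refine ⟨min (ε / 2) (1 / 2), by positivity, fun z hz w hw => ?_⟩
  have hz0 : 0 < ‖z‖ := norm_pos_iff.2 hz.1
  have hd : dist (w / z) 1 ≤ min (ε / 2) (1 / 2) := by
    rw [Metric.mem_closedBall, dist_eq_norm] at hw
    rw [dist_eq_norm, div_sub_one hz.1, norm_div, div_le_iff₀ hz0]
    exact hw
  have hq0 : w / z ≠ 0 := by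
    intro h
    rw [h] at hd
    have := hd.trans (min_le_right _ _)
    norm_num at this
  have hq := hball (lt_of_le_of_lt (hd.trans (min_le_left _ _)) (by linarith))
  rw [Complex.arg_one, dist_zero_right, Real.norm_eq_abs] at hq
  have habs : |z.arg + (w / z).arg| < δ * Real.pi / 2 := by
    have := hz.2
    linarith [abs_add_le z.arg (w / z).arg]
  have hlt := abs_lt.1 habs
  have hw0 : z * (w / z) = w := mul_div_cancel₀ w hz.1
  refine ⟨fun h => hq0 (by rw [h, zero_div]), ?_⟩
  rw [← hw0, Complex.arg_mul hz.1 hq0 ⟨by nlinarith [Real.pi_pos], by nlinarith [Real.pi_pos]⟩]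
  exact habs

theorem norm_iteratedDerivWithin_sector_le {M : ℕ → ℝ} {G : ℂ → ℂ} {γ δ c : ℝ} (hγ : γ < 2)
    (hc : 0 < c) (hsub : ∀ z ∈ Sector γ, Metric.closedBall z (c * ‖z‖) ⊆ Sector δ)
    (hpos : ∀ j, 0 < M j) (hG : DifferentiableOn ℂ G (Sector δ))
    (hle : ∀ z ∈ Sector δ, ∀ k, ‖G z‖ ≤ ‖z‖ ^ k * M k) (j : ℕ) {z : ℂ} (hz : z ∈ Sector γ) :
    ‖iteratedDerivWithin j G (Sector γ) z‖ ≤ ((1 + c) / c) ^ j * (Nat.factorial j : ℝ) * M j := by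
  have hz0 : 0 < ‖z‖ := norm_pos_iff.2 hz.1
  have hR : 0 < c * ‖z‖ := mul_pos hc hz0
  rw [iteratedDerivWithin_of_isOpen (isOpen_sector hγ) hz]
  have hd : DiffContOnCl ℂ G (Metric.ball z (c * ‖z‖)) := by
    refine DifferentiableOn.diffContOnCl ?_
    rw [closure_ball _ hR.ne']
    exact hG.mono (hsub z hz)
  refine (Complex.norm_iteratedDeriv_le_of_forall_mem_sphere_norm_le
    (C := ((1 + c) * ‖z‖) ^ j * M j) j hR hd fun w hw => ?_).trans_eq ?_
  · refine (hle w (hsub z hz (Metric.sphere_subset_closedBall hw)) j).trans ?_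
    have hn : ‖w‖ ≤ (1 + c) * ‖z‖ := by
      rw [mem_sphere_iff_norm] at hw
      have := norm_add_le (w - z) z
      rw [sub_add_cancel] at this
      linarith
    have := hpos j
    gcongr
  · rw [mul_pow, mul_pow, div_pow]
    field_simp

theorem quotient_bounds {M : ℕ → ℝ} (hpos : ∀ j, 0 < M j) {γ s : ℝ} (hγ : 0 < γ) (hs : 0 < s)
    (hsγ : 1 < γ * s) (hP : PropertyP M γ) :
    (∀ t : ℝ, 0 < t → ∃ N, 1 ≤ M (N + 1) / M N * t) ∧
    ∃ K : ℝ, ∀ N k : ℕ, ∑ i ∈ Finset.range k, (M (N + i + 1) / M (N + i)) ^ (-s) ≤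
      K * (N + 1) * (M (N + 1) / M N) ^ (-s) := by
  obtain ⟨B, hB, hq⟩ := hP.quotient_le
  have hpq : ∀ j, 0 < M (j + 1) / M j := fun j => div_pos (hpos _) (hpos _)
  constructor
  · intro t ht
    have hlim : Tendsto (fun i : ℕ => ((i : ℝ) + 1) ^ γ) atTop atTop :=
      (tendsto_rpow_atTop hγ).comp (tendsto_atTop_add_const_right _ _ tendsto_natCast_atTop_atTop)
    obtain ⟨i, hi⟩ := (hlim.eventually_ge_atTop (B / (t * (M 1 / M 0)))).exists
    refine ⟨i, ?_⟩
    have h1 := hq 0 i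
    have h0 := hpq 0
    simp only [zero_add, Nat.cast_one, div_one, Nat.cast_add] at h1 h0
    rw [add_comm (1 : ℝ)] at h1
    rw [div_le_iff₀ (mul_pos ht h0)] at hi
    have h2 := mul_le_mul_of_nonneg_right h1 ht.le
    have h3 : B * 1 ≤ B * (M (i + 1) / M i * t) := by linarith
    exact le_of_mul_le_mul_left h3 hB
  · refine ⟨B ^ s * ∑' i : ℕ, ((i : ℝ) + 1) ^ (-(γ * s)), fun N k => ?_⟩
    have hterm : ∀ i : ℕ, (M (N + i + 1) / M (N + i)) ^ (-s) ≤
        B ^ s * (M (N + 1) / M N) ^ (-s) *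
          (((N + 1 + i : ℕ) : ℝ) / (N + 1 : ℕ)) ^ (-(γ * s)) := by
      intro i
      have hr : (0 : ℝ) < ((N + 1 + i : ℕ) : ℝ) / (N + 1 : ℕ) := by positivity
      have h1 := Real.rpow_le_rpow_of_nonpos
        (mul_pos (Real.rpow_pos_of_pos hr γ) (hpq N)) (hq N i) (by linarith : -s ≤ 0)
      rw [Real.mul_rpow hB.le (hpq _).le, Real.mul_rpow (Real.rpow_nonneg hr.le _) (hpq _).le,
        ← Real.rpow_mul hr.le, Real.rpow_neg hB.le, inv_mul_le_iff₀ (Real.rpow_pos_of_pos hB _)]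
        at h1
      refine h1.trans_eq ?_
      rw [mul_neg]
      ring
    calc _ ≤ ∑ i ∈ Finset.range k, B ^ s * (M (N + 1) / M N) ^ (-s) *
          (((N + 1 + i : ℕ) : ℝ) / (N + 1 : ℕ)) ^ (-(γ * s)) :=
          Finset.sum_le_sum fun i _ => hterm i
      _ = B ^ s * (M (N + 1) / M N) ^ (-s) * ∑ i ∈ Finset.range k,
          (((N + 1 + i : ℕ) : ℝ) / (N + 1 : ℕ)) ^ (-(γ * s)) := by rw [Finset.mul_sum]
      _ ≤ B ^ s * (M (N + 1) / M N) ^ (-s) *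
          ((N + 1 : ℕ) * ∑' i : ℕ, ((i : ℝ) + 1) ^ (-(γ * s))) := by
          have := Real.rpow_pos_of_pos (hpq N) (-s)
          gcongr
          exact sum_range_div_rpow_le hsγ (N + 1) N.succ_pos k
      _ = _ := by push_cast; ring

/-- for strongly regular `M` and `0 < γ < min(γ(M), 2)` there exist a
holomorphic function `G` on the sector `S_γ` and constants `σ, C, κ₁, κ₂, κ₃ > 0`
(depending only on `M` and `γ`) with `|G^{(j)}(z)| ≤ C σ^j j! M_j` for all `j, z ∈ S_γ`
and `κ₁ h_M(κ₂|z|) ≤ |G(z)| ≤ h_M(κ₃|z|)` for every `z ∈ S_γ`. -/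
theorem stmt13 (M : ℕ → ℝ) (hM : StronglyRegular M) (γ : ℝ)
    (hγ0 : 0 < γ) (hγM : γ < growthIndex M) (hγ2 : γ < 2) :
    ∃ (G : ℂ → ℂ) (σ C κ₁ κ₂ κ₃ : ℝ), 0 < σ ∧ 0 < C ∧ 0 < κ₁ ∧ 0 < κ₂ ∧ 0 < κ₃ ∧
      DifferentiableOn ℂ G (Sector γ) ∧
      (∀ (j : ℕ), ∀ z ∈ Sector γ,
        ‖iteratedDerivWithin j G (Sector γ) z‖ ≤ C * σ ^ j * (Nat.factorial j : ℝ) * M j) ∧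
      (∀ z ∈ Sector γ,
        κ₁ * hfn M (κ₂ * ‖z‖) ≤ ‖G z‖ ∧ ‖G z‖ ≤ hfn M (κ₃ * ‖z‖)) := by
  obtain ⟨A, hpos, h0, -⟩ := hM
  obtain ⟨γ', hγγ', hP⟩ := exists_lt_propertyP hγ0 hγM
  have hγ'0 : 0 < γ' := hγ0.trans hγγ'
  obtain ⟨β, hβ1, hβ2⟩ := exists_between hγγ'
  have hβ0 : 0 < β := hγ0.trans hβ1
  obtain ⟨δ, hδ1, hδ2⟩ := exists_between (lt_min hβ1 hγ2)
  have hδβ : δ < β := hδ2.trans_le (min_le_left _ _)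
  have hδ2 : δ < 2 := hδ2.trans_le (min_le_right _ _)
  have hs : 0 < β⁻¹ := inv_pos.2 hβ0
  obtain ⟨hex, K, hK⟩ := quotient_bounds hpos hγ'0 hs
    (by rwa [← div_eq_mul_inv, one_lt_div hβ0]) hP
  have hsum : Summable fun j => (M (j + 1) / M j) ^ (-β⁻¹) :=
    summable_of_sum_range_le (c := K * ((0 : ℕ) + 1) * (M (0 + 1) / M 0) ^ (-β⁻¹))
      (fun j => Real.rpow_nonneg (div_pos (hpos _) (hpos _)).le _)
      fun k => by simpa only [zero_add] using hK 0 k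
  have harg : ∀ z ∈ Sector δ, β⁻¹ * |z.arg| < Real.pi / 2 := fun z hz => by
    rw [inv_mul_lt_iff₀ hβ0]
    nlinarith [hz.2, Real.pi_pos]
  have hslit : Sector δ ⊆ Complex.slitPlane := fun z hz => by
    refine Complex.mem_slitPlane_iff_arg.2 ⟨fun h => ?_, hz.1⟩
    have := hz.2
    rw [h, abs_of_pos Real.pi_pos] at this
    nlinarith [Real.pi_pos]
  have hsub : Sector γ ⊆ Sector δ := fun z hz =>
    ⟨hz.1, hz.2.trans (by nlinarith [Real.pi_pos])⟩
  have hG := (differentiableOn_flatFun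
    (fun j => Real.rpow_pos_of_pos (div_pos (hpos (j + 1)) (hpos j)) (-β⁻¹)) hsum hs).mono
    fun z hz => ⟨hslit hz, harg z hz⟩
  obtain ⟨c, hc, hball⟩ := exists_closedBall_subset_sector hδ1 hδ2
  refine ⟨flatFun (fun j => (M (j + 1) / M j) ^ (-β⁻¹)) β⁻¹, (1 + c) / c, 1,
    Real.exp (-β⁻¹⁻¹ * K), Real.exp (-β⁻¹⁻¹ * (Real.log 2 + K)), 1, by positivity, one_pos,
    Real.exp_pos _, Real.exp_pos _, one_pos, hG.mono hsub, fun j z hz => ?_, fun z hz => ⟨?_, ?_⟩⟩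
  · rw [one_mul]
    exact norm_iteratedDerivWithin_sector_le hγ2 hc hball hpos hG
      (fun z hz => norm_flatFun_le hpos h0 hs hsum hz.1 (harg z hz)) j hz
  · exact le_norm_flatFun hpos h0 hs hsum hex hK hz.1 (harg z (hsub hz))
  · rw [one_mul, hfn, if_neg (norm_ne_zero_iff.2 hz.1)]
    exact le_ciInf (norm_flatFun_le hpos h0 hs hsum hz.1 (harg z (hsub hz)))
end
end
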